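/- For every real number x that is not an integer (in particular x ≠ 0), (sin(πx) − πx·cos(πx)) / (2x²·sin(πx)) = ∑_{k=1}^∞ 1/(k² − x²). -/

import Mathlib

open Real

theorem sum_inv_sq_sub_sq (x : ℝ) (hx : ∀ n : ℤ, x ≠ n) :
    (Real.sin (π * x) - π * x * Real.cos (π * x)) / (2 * x ^ 2 * Real.sin (π * x)) =
      ∑' k : ℕ, 1 / (((k : ℝ) + 1) ^ 2 - x ^ 2) := by
  have hxc : (x : ℂ) ∈ Complex.integerComplement := by
    rintro ⟨n, hn⟩
    exact hx n (by exact_mod_cast hn.symm)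
  have hx0 : x ≠ 0 := by simpa using hx 0
  have hsin : Real.sin (π * x) ≠ 0 := by
    exact_mod_cast sin_pi_mul_ne_zero hxc
  have hterm (k : ℕ) : 1 / (x - (k + 1)) + 1 / (x + (k + 1)) =
      -(2 * x) * (1 / (((k : ℝ) + 1) ^ 2 - x ^ 2)) := by
    have hsub : x - (k + 1) ≠ 0 := by
      simpa [sub_ne_zero] using hx (k + 1)
    have hadd : x + (k + 1) ≠ 0 := fun h => hx (-(k + 1)) (by push_cast; linarith)
    have hsq : ((k : ℝ) + 1) ^ 2 - x ^ 2 ≠ 0 := by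
      rw [show ((k : ℝ) + 1) ^ 2 - x ^ 2 = -((x - (k + 1)) * (x + (k + 1))) by ring]
      exact neg_ne_zero.mpr (mul_ne_zero hsub hadd)
    field_simp
    ring
  have hcot : π * (Real.cos (π * x) / Real.sin (π * x)) - 1 / x =
      ∑' k : ℕ, (1 / (x - (k + 1)) + 1 / (x + (k + 1))) := by
    have h := cot_series_rep' hxc
    rw [Complex.cot] at h
    exact_mod_cast h
  simp_rw [hterm, tsum_mul_left] at hcot
  refine mul_left_cancel₀ (neg_ne_zero.mpr (mul_ne_zero two_ne_zero hx0)) (Eq.trans ?_ hcot)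
  generalize Real.sin (π * x) = s at hsin ⊢
  field_simp
  ring
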